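/- In PSL(2, F₇), no subgroup of order 12 arises as the intersection of two non-conjugate subgroups of order 24. -/

import Mathlib

open scoped Pointwise

lemma aux_prime7 : Fact (Nat.Prime 7) := ⟨by norm_num⟩

lemma aux_card_SL : Nat.card (Matrix.SpecialLinearGroup (Fin 2) (ZMod 7)) ∣ 336 := by
  have := aux_prime7
  have hGL : Nat.card (GL (Fin 2) (ZMod 7)) = 2016 := by
    rw [Matrix.card_GL_field]; simp [Fin.prod_univ_two, ZMod.card]
  let d : GL (Fin 2) (ZMod 7) →* (ZMod 7)ˣ := Matrix.GeneralLinearGroup.det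
  have hsurj : Function.Surjective d := Matrix.GeneralLinearGroup.det_surjective
  have hidx : d.ker.index = 6 := by
    rw [Subgroup.index_ker, MonoidHom.range_eq_top.2 hsurj, Subgroup.card_top,
      Nat.card_eq_fintype_card, ZMod.card_units_eq_totient]
    decide
  have hk : Nat.card d.ker = 336 := by
    have := d.ker.card_mul_index
    rw [hidx, hGL] at this
    omega
  let f : Matrix.SpecialLinearGroup (Fin 2) (ZMod 7) →* GL (Fin 2) (ZMod 7) :=
    Matrix.SpecialLinearGroup.toGL
  have hf : Function.Injective f := Matrix.SpecialLinearGroup.toGL_injective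
  rw [← hk, Nat.card_congr (MonoidHom.ofInjective hf).toEquiv]
  apply Subgroup.card_dvd_of_le
  rintro _ ⟨x, rfl⟩
  rw [MonoidHom.mem_ker]
  ext
  exact x.2

lemma aux_card_PSL :
    ∃ z, 2 ≤ z ∧ Nat.card (Matrix.ProjectiveSpecialLinearGroup (Fin 2) (ZMod 7)) * z ∣ 336 := by
  have := aux_prime7
  refine ⟨Nat.card (Subgroup.center (Matrix.SpecialLinearGroup (Fin 2) (ZMod 7))), ?_, ?_⟩
  · have : Nontrivial (Subgroup.center (Matrix.SpecialLinearGroup (Fin 2) (ZMod 7))) := by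
      refine ⟨⟨1, ⟨-1, ?_⟩, ?_⟩⟩
      · rw [Subgroup.mem_center_iff]; intro g; simp
      · intro h
        have h1 := congrArg (fun x : Subgroup.center (Matrix.SpecialLinearGroup (Fin 2) (ZMod 7)) =>
          (x : Matrix.SpecialLinearGroup (Fin 2) (ZMod 7)) 0 0) h
        revert h1
        simp
        decide
    exact Finite.one_lt_card
  · rw [← Subgroup.card_eq_card_quotient_mul_card_subgroup]
    exact aux_card_SL

lemma aux_le_normalizer {G : Type*} [Group G] {D E : Subgroup G}
    (hD : Nat.card D = 12) (hE : Nat.card E = 24) (h : D ≤ E) :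
    E ≤ Subgroup.normalizer (D : Set G) := by
  rw [← Subgroup.normal_subgroupOf_iff_le_normalizer h]
  apply Subgroup.normal_of_index_eq_two
  have h1 := (D.subgroupOf E).card_mul_index
  rw [Nat.card_congr (Subgroup.subgroupOfEquivOfLe h).toEquiv, hD, hE] at h1
  omega

/-- In `PSL(2, F₇)`, no subgroup of order 12 is the intersection of two non-conjugate
subgroups of order 24. -/
theorem psl27_no_order12_intersection_of_nonconjugate_order24 :
    ¬ ∃ (D E F : Subgroup (Matrix.ProjectiveSpecialLinearGroup (Fin 2) (ZMod 7))),
      Nat.card D = 12 ∧ Nat.card E = 24 ∧ Nat.card F = 24 ∧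
      (∀ g : Matrix.ProjectiveSpecialLinearGroup (Fin 2) (ZMod 7), MulAut.conj g • E ≠ F) ∧
      D = E ⊓ F := by
  rintro ⟨D, E, F, hD, hE, hF, hc, hDEF⟩
  have := aux_prime7
  have hEF : E ≠ F := by simpa using hc 1
  have hS : IsSimpleGroup (Matrix.ProjectiveSpecialLinearGroup (Fin 2) (ZMod 7)) :=
    Matrix.ProjectiveSpecialLinearGroup.rank_two_simple (by simp)
  have hEN := aux_le_normalizer hD hE (hDEF ▸ inf_le_left)
  have hFN := aux_le_normalizer hD hF (hDEF ▸ inf_le_right)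
  set N := Subgroup.normalizer (D : Set (Matrix.ProjectiveSpecialLinearGroup (Fin 2) (ZMod 7)))
    with hN
  obtain ⟨z, hz, hGz⟩ := aux_card_PSL
  obtain ⟨b, hb⟩ := hE ▸ Subgroup.card_dvd_of_le hEN
  have hNi := N.card_mul_index
  have hb1 : b ≠ 1 := by
    rintro rfl
    apply hEF
    rw [Subgroup.eq_of_le_of_card_ge hEN (by omega), Subgroup.eq_of_le_of_card_ge hFN (by omega)]
  have hi : N.index = 1 := by
    rw [← hNi, hb] at hGz
    generalize N.index = i at *
    have h14 : b * i * z ∣ 14 := by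
      apply Nat.dvd_of_mul_dvd_mul_left (k := 24) (by norm_num)
      convert hGz using 1
      ring
    obtain ⟨c, hc⟩ := h14
    have hb0 : b ≠ 0 := by rintro rfl; simp at hc
    have hi0 : i ≠ 0 := by rintro rfl; simp at hc
    by_contra hi1
    have hbd : b ∣ 14 := ⟨i * z * c, by rw [hc]; ring⟩
    have hid : i ∣ 14 := ⟨b * z * c, by rw [hc]; ring⟩
    have hzd : z ∣ 14 := ⟨b * i * c, by rw [hc]; ring⟩
    have hle : b * i * z ≤ 14 := Nat.le_of_dvd (by norm_num) ⟨c, hc⟩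
    have h4 : b * i * z ∣ 14 := ⟨c, hc⟩
    have := Nat.le_of_dvd (by norm_num) hbd
    have := Nat.le_of_dvd (by norm_num) hid
    have := Nat.le_of_dvd (by norm_num) hzd
    clear hc
    interval_cases b <;> first | omega | skip
    all_goals interval_cases i <;> first | omega | skip
    all_goals interval_cases z <;> omega
  have hDn : D.Normal := by
    rw [← Subgroup.normalizer_eq_top_iff]
    exact Subgroup.index_eq_one.1 hi
  rcases hS.eq_bot_or_eq_top_of_normal D hDn with h | h
  · rw [h] at hD; simp at hD
  · have : E ≤ D := h ▸ le_top
    have := Subgroup.card_dvd_of_le this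
    rw [hD, hE] at this
    omega
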